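/- For each Euclidean unit vector ν let μ⁻¹(ν) ∈ S denote the unique point m with ⟨ν,z⟩ ≤ ⟨ν,m⟩ for all z with N(z) ≤ 1 (the inverse Gauss map), and for v ∈ S with ⟨ν,v⟩ > 0 set λ(ν,v) = ⟨ν, μ⁻¹(ν)⟩/⟨ν,v⟩ and Λ(ν,v) = (λ(ν,v) − 1)/N(μ⁻¹(ν) − v) when μ⁻¹(ν) ≠ v, Λ(ν,v) = 0 otherwise. Then for every fixed v₀ ∈ S, the function L_{v₀}(ν) = Λ(ν, v₀) is continuous on the set {ν ∈ E : |ν| = 1, ⟨ν, v₀⟩ > 0}. -/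

import Mathlib

open scoped RealInnerProductSpace

/- `Λ(ν,v) = (λ(ν,v) - 1) / N (μ⁻¹(ν) - v)` where `λ(ν,v) = ⟪ν, μ⁻¹(ν)⟫/⟪ν,v⟫` is the
unique scalar with `λ(ν,v) • v - μ⁻¹(ν)` Euclidean-orthogonal to `ν`; and
`Λ(ν,v) = 0` when `μ⁻¹(ν) = v`. -/
open Classical in
noncomputable def Lam {n : ℕ} (N : EuclideanSpace ℝ (Fin n) → ℝ)
    (μinv : EuclideanSpace ℝ (Fin n) → EuclideanSpace ℝ (Fin n))
    (ν v : EuclideanSpace ℝ (Fin n)) : ℝ :=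
  if μinv ν = v then 0
  else (⟪ν, μinv ν⟫ / ⟪ν, v⟫ - 1) / N (μinv ν - v)

section StrictlyConvexGauge

variable {E : Type*} [NormedAddCommGroup E] [InnerProductSpace ℝ E]

/-- A subadditive, absolutely homogeneous function on a finite-dimensional space is continuous. -/
theorem continuous_of_abs_homogeneous_of_subadditive [FiniteDimensional ℝ E] {N : E → ℝ}
    (hNh : ∀ (c : ℝ) (z : E), N (c • z) = |c| * N z)
    (hNt : ∀ z w : E, N (z + w) ≤ N z + N w) : Continuous N := by
  have hconv : ConvexOn ℝ Set.univ N := by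
    refine ⟨convex_univ, fun x _ y _ a b ha hb _ => (hNt _ _).trans_eq ?_⟩
    rw [hNh, hNh, abs_of_nonneg ha, abs_of_nonneg hb, smul_eq_mul, smul_eq_mul]
  exact continuousOn_univ.mp (hconv.continuousOn isOpen_univ)

/-- A subadditive, absolutely homogeneous function is nonnegative. -/
theorem nonneg_of_abs_homogeneous_of_subadditive {N : E → ℝ}
    (hNh : ∀ (c : ℝ) (z : E), N (c • z) = |c| * N z)
    (hNt : ∀ z w : E, N (z + w) ≤ N z + N w) (x : E) : 0 ≤ N x := by
  have h := hNt x ((-1 : ℝ) • x)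
  have h0 := hNh 0 x
  rw [hNh] at h
  simp at h h0
  linarith

/-- A norm on a finite-dimensional space dominates a multiple of the given norm. -/
theorem exists_norm_le_mul_of_norm [FiniteDimensional ℝ E] {N : E → ℝ}
    (hN0 : ∀ z, N z = 0 ↔ z = 0)
    (hNh : ∀ (c : ℝ) (z : E), N (c • z) = |c| * N z)
    (hNt : ∀ z w : E, N (z + w) ≤ N z + N w) :
    ∃ C : ℝ, 0 ≤ C ∧ ∀ x, ‖x‖ ≤ C * N x := by
  have hcont := continuous_of_abs_homogeneous_of_subadditive hNh hNt
  have hnn := nonneg_of_abs_homogeneous_of_subadditive hNh hNt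
  rcases (Metric.sphere (0 : E) 1).eq_empty_or_nonempty with hE | hE
  · refine ⟨0, le_rfl, fun x => ?_⟩
    by_cases hx : x = 0
    · simp [hx]
    · have : ‖x‖⁻¹ • x ∈ Metric.sphere (0 : E) 1 := by
        simp [norm_smul, norm_ne_zero_iff.mpr hx]
      simp [hE] at this
  · obtain ⟨u, hu, hmin⟩ := (isCompact_sphere (0 : E) 1).exists_isMinOn hE hcont.continuousOn
    have hNu : 0 < N u := by
      refine (hnn u).lt_of_ne fun h => ?_
      rw [(hN0 u).mp h.symm] at hu
      simp at hu
    refine ⟨(N u)⁻¹, inv_nonneg.mpr hNu.le, fun x => ?_⟩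
    by_cases hx : x = 0
    · simp [hx, (hN0 0).mpr rfl]
    · have hxpos : 0 < ‖x‖ := norm_pos_iff.mpr hx
      have hmem : ‖x‖⁻¹ • x ∈ Metric.sphere (0 : E) 1 := by
        simp [norm_smul, hxpos.ne']
      have h : N u ≤ N (‖x‖⁻¹ • x) := hmin hmem
      rw [hNh, abs_of_pos (inv_pos.mpr hxpos), inv_mul_eq_div, le_div_iff₀ hxpos] at h
      rwa [inv_mul_eq_div, le_div_iff₀ hNu, mul_comm]

/-- A nonzero linear functional attains its maximum over the unit ball of a strictly convex norm
at no more than one point of the unit sphere. -/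
theorem eq_of_isMax_inner_of_strictConvex {N : E → ℝ}
    (hN0 : ∀ z, N z = 0 ↔ z = 0)
    (hNh : ∀ (c : ℝ) (z : E), N (c • z) = |c| * N z)
    (hNt : ∀ z w : E, N (z + w) ≤ N z + N w)
    (hsc : ∀ x y : E, N x = 1 → N y = 1 → x ≠ y → N ((2 : ℝ)⁻¹ • (x + y)) < 1)
    {ν x y : E} (hν : ν ≠ 0) (hx : N x = 1) (hy : N y = 1)
    (hxmax : ∀ z, N z ≤ 1 → ⟪ν, z⟫ ≤ ⟪ν, x⟫) (hymax : ∀ z, N z ≤ 1 → ⟪ν, z⟫ ≤ ⟪ν, y⟫) :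
    x = y := by
  have hnn := nonneg_of_abs_homogeneous_of_subadditive hNh hNt
  have hpos : ∀ {w : E}, w ≠ 0 → 0 < N w := fun {w} hw =>
    (hnn w).lt_of_ne fun h => hw ((hN0 w).mp h.symm)
  have hbound : ∀ {w : E}, w ≠ 0 → ⟪ν, w⟫ ≤ ⟪ν, x⟫ * N w := fun {w} hw => by
    have h := hxmax ((N w)⁻¹ • w) (by
      rw [hNh, abs_of_pos (inv_pos.mpr (hpos hw)), inv_mul_cancel₀ (hpos hw).ne'])
    rwa [real_inner_smul_right, inv_mul_eq_div, div_le_iff₀ (hpos hw)] at h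
  have hmax : 0 < ⟪ν, x⟫ := by
    have h := hbound hν
    have hνν : 0 < ⟪ν, ν⟫ := real_inner_self_pos.mpr hν
    exact pos_of_mul_pos_left (hνν.trans_le h) (hnn ν)
  by_contra hne
  have hlt := hsc x y hx hy hne
  have hxy : ⟪ν, x⟫ = ⟪ν, y⟫ := le_antisymm (hymax x hx.le) (hxmax y hy.le)
  have hmid : ⟪ν, (2 : ℝ)⁻¹ • (x + y)⟫ = ⟪ν, x⟫ := by
    rw [real_inner_smul_right, inner_add_right, ← hxy]
    ring
  have hw : (2 : ℝ)⁻¹ • (x + y) ≠ 0 := by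
    intro h
    rw [h, inner_zero_right] at hmid
    exact hmax.ne hmid
  have h := hbound hw
  rw [hmid] at h
  nlinarith

/-- The inverse Gauss map of a strictly convex norm is continuous on the Euclidean unit sphere. -/
theorem continuousOn_inverseGaussMap [FiniteDimensional ℝ E] {N : E → ℝ}
    (hN0 : ∀ z, N z = 0 ↔ z = 0)
    (hNh : ∀ (c : ℝ) (z : E), N (c • z) = |c| * N z)
    (hNt : ∀ z w : E, N (z + w) ≤ N z + N w)
    (hsc : ∀ x y : E, N x = 1 → N y = 1 → x ≠ y → N ((2 : ℝ)⁻¹ • (x + y)) < 1)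
    {μinv : E → E}
    (hμ : ∀ ν, ‖ν‖ = 1 → N (μinv ν) = 1 ∧ ∀ z, N z ≤ 1 → ⟪ν, z⟫ ≤ ⟪ν, μinv ν⟫) :
    ContinuousOn μinv {ν | ‖ν‖ = 1} := by
  have hcont := continuous_of_abs_homogeneous_of_subadditive hNh hNt
  obtain ⟨C, -, hC⟩ := exists_norm_le_mul_of_norm hN0 hNh hNt
  have hK : IsCompact {x | N x = 1} := by
    refine (isCompact_closedBall (0 : E) C).of_isClosed_subset
      (isClosed_eq hcont continuous_const) fun x hx => ?_
    have h := hC x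
    rw [Set.mem_ofPred_eq.mp hx, mul_one] at h
    simpa using h
  intro ν hν
  refine hK.tendsto_nhds_of_unique_mapClusterPt
    (eventually_mem_nhdsWithin.mono fun ξ hξ => (hμ ξ hξ).1) fun y hy hcl => ?_
  obtain ⟨U, hU, hUy⟩ := mapClusterPt_iff_ultrafilter.mp hcl
  have hid : Filter.Tendsto (fun ξ : E => ξ) U (nhds ν) := hU.trans nhdsWithin_le_nhds
  have hev : ∀ᶠ ξ in (U : Filter E), ‖ξ‖ = 1 := hU eventually_mem_nhdsWithin
  have hν0 : ν ≠ 0 := norm_ne_zero_iff.mp (by rw [Set.mem_ofPred_eq.mp hν]; exact one_ne_zero)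
  refine eq_of_isMax_inner_of_strictConvex hN0 hNh hNt hsc hν0 hy (hμ ν hν).1
    (fun z hz => ?_) (hμ ν hν).2
  exact le_of_tendsto_of_tendsto (hid.inner tendsto_const_nhds) (hid.inner hUy)
    (hev.mono fun ξ hξ => (hμ ξ hξ).2 z hz)

end StrictlyConvexGauge

/-- For every fixed `v₀` on the unit sphere of `N`, the function
`L_{v₀} : ν ↦ Λ(ν, v₀)` is continuous on `{ν : |ν| = 1, ⟪ν, v₀⟫ > 0}`. -/
theorem lambda_section_continuous {n : ℕ}
    (N : EuclideanSpace ℝ (Fin n) → ℝ)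
    (hN0 : ∀ z, N z = 0 ↔ z = 0)
    (hNh : ∀ (c : ℝ) (z : EuclideanSpace ℝ (Fin n)), N (c • z) = |c| * N z)
    (hNt : ∀ z w : EuclideanSpace ℝ (Fin n), N (z + w) ≤ N z + N w)
    (hsc : ∀ x y : EuclideanSpace ℝ (Fin n), N x = 1 → N y = 1 → x ≠ y →
      N ((2 : ℝ)⁻¹ • (x + y)) < 1)
    (μinv : EuclideanSpace ℝ (Fin n) → EuclideanSpace ℝ (Fin n))
    (hμ : ∀ ν, ‖ν‖ = 1 → N (μinv ν) = 1 ∧ ∀ z, N z ≤ 1 → ⟪ν, z⟫ ≤ ⟪ν, μinv ν⟫)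
    (v₀ : EuclideanSpace ℝ (Fin n)) (hv₀ : N v₀ = 1) :
    ContinuousOn (fun ν => Lam N μinv ν v₀)
      {ν : EuclideanSpace ℝ (Fin n) | ‖ν‖ = 1 ∧ 0 < ⟪ν, v₀⟫} := by
  have hcont := continuous_of_abs_homogeneous_of_subadditive hNh hNt
  have hnn := nonneg_of_abs_homogeneous_of_subadditive hNh hNt
  obtain ⟨C, hC0, hC⟩ := exists_norm_le_mul_of_norm hN0 hNh hNt
  intro ν hν
  have hM : ContinuousWithinAt μinv {ν | ‖ν‖ = 1 ∧ 0 < ⟪ν, v₀⟫} ν :=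
    ((continuousOn_inverseGaussMap hN0 hNh hNt hsc hμ).mono fun _ h => h.1) ν hν
  have hin : ContinuousWithinAt (fun ξ => ⟪ξ, v₀⟫) {ν | ‖ν‖ = 1 ∧ 0 < ⟪ν, v₀⟫} ν :=
    continuousWithinAt_id.inner continuousWithinAt_const
  by_cases hm : μinv ν = v₀
  · have hval : Lam N μinv ν v₀ = 0 := if_pos hm
    have hlim : Filter.Tendsto (fun ξ => C * ‖ξ - ν‖ / ⟪ξ, v₀⟫)
        (nhdsWithin ν {ν | ‖ν‖ = 1 ∧ 0 < ⟪ν, v₀⟫}) (nhds 0) := by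
      have h : ContinuousWithinAt (fun ξ => C * ‖ξ - ν‖ / ⟪ξ, v₀⟫)
          {ν | ‖ν‖ = 1 ∧ 0 < ⟪ν, v₀⟫} ν :=
        ContinuousWithinAt.div (by fun_prop) hin hν.2.ne'
      simpa [ContinuousWithinAt] using h
    have hbd : ∀ ξ : EuclideanSpace ℝ (Fin n), ‖ξ‖ = 1 ∧ 0 < ⟪ξ, v₀⟫ →
        0 ≤ Lam N μinv ξ v₀ ∧ Lam N μinv ξ v₀ ≤ C * ‖ξ - ν‖ / ⟪ξ, v₀⟫ := by
      rintro ξ ⟨hξ, hξv⟩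
      unfold Lam
      split_ifs with h
      · exact ⟨le_rfl, by positivity⟩
      have hNpos : 0 < N (μinv ξ - v₀) :=
        (hnn _).lt_of_ne fun h' => h (sub_eq_zero.mp ((hN0 _).mp h'.symm))
      rw [div_sub_one hξv.ne', ← inner_sub_right]
      have h₁ : 0 ≤ ⟪ξ, μinv ξ - v₀⟫ := by
        rw [inner_sub_right, sub_nonneg]
        exact (hμ ξ hξ).2 v₀ hv₀.le
      have h₂ : ⟪ν, μinv ξ - v₀⟫ ≤ 0 := by
        rw [inner_sub_right, sub_nonpos, ← hm]
        exact (hμ ν hν.1).2 _ (hμ ξ hξ).1.le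
      have h₃ : ⟪ξ, μinv ξ - v₀⟫ ≤ C * ‖ξ - ν‖ * N (μinv ξ - v₀) :=
        calc ⟪ξ, μinv ξ - v₀⟫ ≤ ⟪ξ - ν, μinv ξ - v₀⟫ := by
              rw [inner_sub_left]; linarith
          _ ≤ ‖ξ - ν‖ * ‖μinv ξ - v₀‖ := real_inner_le_norm _ _
          _ ≤ ‖ξ - ν‖ * (C * N (μinv ξ - v₀)) := by gcongr; exact hC _
          _ = C * ‖ξ - ν‖ * N (μinv ξ - v₀) := by ring
      refine ⟨by positivity, ?_⟩
      rw [div_right_comm]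
      gcongr
      rwa [div_le_iff₀ hNpos]
    refine (tendsto_of_tendsto_of_tendsto_of_le_of_le' tendsto_const_nhds hlim
      (eventually_mem_nhdsWithin.mono fun ξ hξ => (hbd ξ hξ).1)
      (eventually_mem_nhdsWithin.mono fun ξ hξ => (hbd ξ hξ).2)).trans_eq ?_
    exact congrArg nhds hval.symm
  · have hNne : N (μinv ν - v₀) ≠ 0 := fun h => hm (sub_eq_zero.mp ((hN0 _).mp h))
    have hquot : ContinuousWithinAt
        (fun ξ => (⟪ξ, μinv ξ⟫ / ⟪ξ, v₀⟫ - 1) / N (μinv ξ - v₀))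
        {ν | ‖ν‖ = 1 ∧ 0 < ⟪ν, v₀⟫} ν :=
      (((continuousWithinAt_id.inner hM).div hin hν.2.ne').sub continuousWithinAt_const).div
        (hcont.continuousAt.comp_continuousWithinAt (hM.sub continuousWithinAt_const)) hNne
    refine hquot.congr_of_eventuallyEq ?_ (if_neg hm)
    filter_upwards [hM.eventually_ne hm] with ξ hξ
    exact if_neg hξ
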